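/- Let d ≥ 2 and j, k ∈ {1,…,d} with j ≠ k. For every smooth compactly supported F : ℝ^d → ℝ and every x ∈ ℝ^d, lim_{ε→0⁺} Σ_{m ∈ ℤ^d} K_dis^{(jk)}(m) F(x − ε m) = lim_{r→0⁺} c_d ∫_{|y|>r} y_j y_k |y|^{−(d+2)} F(x − y) dy, both limits existing. -/

import Mathlib

open MeasureTheory Real Filter

noncomputable section

/-- The lattice ℤ^d. -/
abbrev ZLat (d : ℕ) := Fin d → ℤ

/-- Embedding of the lattice ℤ^d into Euclidean space ℝ^d. -/
def latVec {d : ℕ} (m : ZLat d) : EuclideanSpace ℝ (Fin d) := WithLp.toLp 2 fun i => (m i : ℝ)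

/-- The (Gaussian) heat kernel on ℝ^d. -/
def heatK (d : ℕ) (t : ℝ) (x : EuclideanSpace ℝ (Fin d)) : ℝ :=
  (2 * π * t) ^ (-(d : ℝ) / 2) * Real.exp (-‖x‖ ^ 2 / (2 * t))

/-- The periodic heat kernel H_t(x) = Σ_{n ∈ ℤ^d} P_t(x − n). -/
def pHeatK (d : ℕ) (t : ℝ) (x : EuclideanSpace ℝ (Fin d)) : ℝ :=
  ∑' n : ZLat d, heatK d t (x - latVec n)

/-- Partial derivative in the j-th coordinate direction. -/
def pderiv {d : ℕ} (j : Fin d) (f : EuclideanSpace ℝ (Fin d) → ℝ)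
    (x : EuclideanSpace ℝ (Fin d)) : ℝ :=
  fderiv ℝ f x (EuclideanSpace.single j 1)

/-- The constant c_d = π^{-d/2} Γ((d+2)/2). -/
def cConst (d : ℕ) : ℝ := π ^ (-(d : ℝ) / 2) * Real.Gamma (((d : ℝ) + 2) / 2)

/-- The discrete second-order Riesz kernel K_dis^{(jk)}. -/
def discK (d : ℕ) (j k : Fin d) (m : ZLat d) : ℝ :=
  if m = 0 then 0 else cConst d * (m j : ℝ) * (m k : ℝ) / ‖latVec m‖ ^ (d + 2)

/-- The discrete second-order Riesz transform R_dis^{(jk)}. -/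
def Rdis (d : ℕ) (j k : Fin d) (f : ZLat d → ℝ) (n : ZLat d) : ℝ :=
  ∑' m : ZLat d, discK d j k m * f (n - m)

/-- The probabilistic kernel 𝒦^{(jk)}(m). -/
def probK (d : ℕ) (j k : Fin d) (m : ZLat d) : ℝ :=
  -∫ s in Set.Ioi (0 : ℝ), ∫ x : EuclideanSpace ℝ (Fin d),
      pHeatK d s x *
        (pderiv j (fun y => heatK d s y / pHeatK d s y) x *
         pderiv k (fun y => heatK d s (y - latVec m) / pHeatK d s y) x)

/-- The probabilistic discrete second-order Riesz transform 𝓡^{(jk)}. -/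
def Rprob (d : ℕ) (j k : Fin d) (f : ZLat d → ℝ) (n : ZLat d) : ℝ :=
  ∑' m : ZLat d, probK d j k (n - m) * f m

/-- The ℓ^p norm of f : ℤ^d → ℝ. -/
def lpN (d : ℕ) (p : ℝ) (f : ZLat d → ℝ) : ℝ := (∑' n : ZLat d, |f n| ^ p) ^ (1 / p)

/-- Membership in ℓ^p(ℤ^d). -/
def MemLpLat (d : ℕ) (p : ℝ) (f : ZLat d → ℝ) : Prop := Summable fun n : ZLat d => |f n| ^ p

/-- Operator norm of an operator on ℓ^p(ℤ^d): sup of ‖Tf‖ over ‖f‖ = 1. -/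
def opN (d : ℕ) (p : ℝ) (T : (ZLat d → ℝ) → (ZLat d → ℝ)) : ℝ :=
  sSup {c : ℝ | ∃ f : ZLat d → ℝ, MemLpLat d p f ∧ lpN d p f = 1 ∧ c = lpN d p (T f)}

/-- p* = max{p, p/(p-1)}. -/
def pstar (p : ℝ) : ℝ := max p (p / (p - 1))


abbrev EE (d : ℕ) := EuclideanSpace ℝ (Fin d)

def flo {d : ℕ} (y : EE d) : ZLat d := fun i => ⌊y i⌋

lemma flo_meas {d : ℕ} : Measurable (flo : EE d → ZLat d) := by
  unfold flo
  refine measurable_pi_lambda _ fun i => Int.measurable_floor.comp ?_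
  fun_prop

lemma latVec_apply {d : ℕ} (m : ZLat d) (i : Fin d) : latVec m i = (m i : ℝ) := rfl

lemma flo_map {d : ℕ} : Measure.map (flo : EE d → ZLat d) volume = Measure.count := by
  refine Measure.ext_of_singleton fun a => ?_
  rw [Measure.map_apply flo_meas (measurableSet_singleton a), Measure.count_singleton]
  have h : (flo : EE d → ZLat d) ⁻¹' {a}
      = (WithLp.ofLp : EE d → (Fin d → ℝ)) ⁻¹' (Set.univ.pi fun i => Set.Ico (a i : ℝ) (a i + 1)) := by
    ext y
    simp [flo, funext_iff, Int.floor_eq_iff]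
  rw [h, (PiLp.volume_preserving_ofLp (Fin d)).measure_preimage
    (MeasurableSet.univ_pi fun i => measurableSet_Ico).nullMeasurableSet, volume_pi_pi]
  simp

lemma integral_flo {d : ℕ} (φ : ZLat d → ℝ) (hφ : Summable φ) :
    ∫ y : EE d, φ (flo y) = ∑' m, φ m := by
  have hi : Integrable φ (Measure.count : Measure (ZLat d)) := integrable_count_iff.2 hφ.norm
  have h1 : ∫ y : EE d, φ (flo y) = ∫ m, φ m ∂(Measure.map (flo : EE d → ZLat d) volume) :=
    (integral_map flo_meas.aemeasurable (measurable_of_countable φ).aestronglyMeasurable).symm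
  rw [h1, flo_map, integral_countable hi]
  simp [Measure.real]

lemma latVec_flo_norm {d : ℕ} (y : EE d) : ‖y - latVec (flo y)‖ ≤ d := by
  have h1 : ‖y - latVec (flo y)‖ ≤ ∑ i : Fin d, |(y - latVec (flo y)) i| := by
    conv_lhs => rw [← (EuclideanSpace.basisFun (Fin d) ℝ).sum_repr (y - latVec (flo y))]
    refine (norm_sum_le _ _).trans (Finset.sum_le_sum fun i _ => ?_)
    rw [norm_smul]; simp
  refine h1.trans ?_
  calc _ ≤ ∑ i : Fin d, (1 : ℝ) := by
        refine Finset.sum_le_sum fun i _ => ?_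
        simp only [PiLp.sub_apply, latVec_apply, flo]
        rw [abs_le]; constructor <;> linarith [Int.floor_le (y i), Int.lt_floor_add_one (y i)]
    _ = d := by simp

lemma coord_le {d : ℕ} (y : EE d) (i : Fin d) : |y i| ≤ ‖y‖ := by
  simpa using PiLp.norm_apply_le y i

lemma latVec_norm_ge {d : ℕ} (m : ZLat d) (hm : m ≠ 0) : 1 ≤ ‖latVec m‖ := by
  obtain ⟨i, hi⟩ := Function.ne_iff.1 hm
  refine le_trans ?_ (coord_le (latVec m) i)
  rw [latVec_apply, ← Int.cast_abs]
  exact_mod_cast Int.one_le_abs hi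

lemma latVec_zero {d : ℕ} : latVec (0 : ZLat d) = 0 := by
  ext i; simp [latVec_apply]

lemma fin_lat {d : ℕ} (ε : ℝ) (hε : 0 < ε) (R : ℝ) :
    {m : ZLat d | ‖ε • latVec m‖ ≤ R}.Finite := by
  refine (Set.finite_Icc (fun _ => -⌈R / ε⌉ : ZLat d) (fun _ => ⌈R / ε⌉)).subset fun m hm => ?_
  have hm' : ‖latVec m‖ ≤ R / ε := by
    rw [le_div_iff₀ hε]
    have : ‖ε • latVec m‖ ≤ R := hm
    rw [norm_smul, Real.norm_of_nonneg hε.le] at this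
    linarith
  have key : ∀ i, |m i| ≤ ⌈R / ε⌉ := fun i => by
    have h1 : |(m i : ℝ)| ≤ (⌈R / ε⌉ : ℝ) :=
      (coord_le (latVec m) i).trans (hm'.trans (Int.le_ceil _))
    rw [← Int.cast_abs] at h1
    exact Int.cast_le.1 h1
  exact ⟨fun i => (abs_le.1 (key i)).1, fun i => (abs_le.1 (key i)).2⟩

/-- dominating function -/
def dom (d : ℕ) (C R : ℝ) (y : EE d) : ℝ :=
  (Set.Iic R).indicator (fun t : ℝ => C * (t ^ (d - 1))⁻¹) ‖y‖

lemma dom_int (d : ℕ) (hd : 2 ≤ d) (C R : ℝ) : Integrable (dom d C R) := by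
  have : Nontrivial (EE d) := by
    have : Nonempty (Fin d) := ⟨⟨0, by omega⟩⟩
    infer_instance
  unfold dom
  rw [integrable_fun_norm_addHaar (volume : Measure (EE d))
    (f := (Set.Iic R).indicator (fun t : ℝ => C * (t ^ (d - 1))⁻¹))]
  have h1 : IntegrableOn ((Set.Iic R).indicator fun _ : ℝ => C) (Set.Ioi 0) := by
    rw [integrableOn_indicator_iff measurableSet_Iic, Set.inter_comm, Set.Ioi_inter_Iic]
    exact integrableOn_const (by simp)
  refine h1.congr_fun (fun t ht => ?_) measurableSet_Ioi
  have ht' : t ≠ 0 := (ne_of_gt ht)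
  by_cases h : t ∈ Set.Iic R
  · simp only [Set.indicator_of_mem h, finrank_euclideanSpace, Fintype.card_fin, smul_eq_mul]
    field_simp
  · simp [Set.indicator_of_notMem h]

lemma dom_nonneg {d : ℕ} {C R : ℝ} (hC : 0 ≤ C) (y : EE d) : 0 ≤ dom d C R y := by
  unfold dom
  by_cases h : ‖y‖ ∈ Set.Iic R
  · rw [Set.indicator_of_mem h]; positivity
  · rw [Set.indicator_of_notMem h]

lemma le_dom {d : ℕ} {C R : ℝ} (hC : 0 ≤ C) {h : EE d → ℝ}
    (hb : ∀ y, |h y| ≤ C * (‖y‖ ^ (d - 1))⁻¹) (hs : ∀ y, h y ≠ 0 → ‖y‖ ≤ R) (y : EE d) :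
    |h y| ≤ dom d C R y := by
  by_cases h0 : h y = 0
  · rw [h0, abs_zero]
    exact dom_nonneg hC y
  · unfold dom
    rw [Set.indicator_of_mem (show ‖y‖ ∈ Set.Iic R from hs y h0)]
    exact hb y

lemma riemann {d : ℕ} (hd : 2 ≤ d) {C R : ℝ} (hC : 0 ≤ C) {h : EE d → ℝ}
    (h0 : h 0 = 0) (hc : ∀ y, y ≠ 0 → ContinuousAt h y)
    (hb : ∀ y, |h y| ≤ C * (‖y‖ ^ (d - 1))⁻¹) (hs : ∀ y, h y ≠ 0 → ‖y‖ ≤ R) :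
    Tendsto (fun ε : ℝ => ε ^ d * ∑' m : ZLat d, h (ε • latVec m))
      (nhdsWithin 0 (Set.Ioi 0)) (nhds (∫ y, h y)) := by
  have : Nonempty (Fin d) := ⟨⟨0, by omega⟩⟩
  have key : ∀ ε : ℝ, 0 < ε → ε ^ d * ∑' m : ZLat d, h (ε • latVec m)
      = ∫ y : EE d, h (ε • latVec (flo (ε⁻¹ • y))) := by
    intro ε hε
    rw [← integral_flo, Measure.integral_comp_smul volume (fun y : EE d => h (ε • latVec (flo y)))]
    · rw [finrank_euclideanSpace, Fintype.card_fin, abs_of_nonneg (by positivity)]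
      simp
    · refine summable_of_hasFiniteSupport ((fin_lat ε hε R).subset fun m hm => hs _ hm)
  have near : ∀ ε : ℝ, 0 < ε → ∀ y : EE d, ‖y - ε • latVec (flo (ε⁻¹ • y))‖ ≤ ε * d := by
    intro ε hε y
    have : y - ε • latVec (flo (ε⁻¹ • y)) = ε • (ε⁻¹ • y - latVec (flo (ε⁻¹ • y))) := by
      rw [smul_sub, smul_smul, mul_inv_cancel₀ hε.ne', one_smul]
    rw [this, norm_smul, Real.norm_of_nonneg hε.le]
    gcongr
    exact latVec_flo_norm _
  have hT : Tendsto (fun ε : ℝ => ∫ y : EE d, h (ε • latVec (flo (ε⁻¹ • y))))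
      (nhdsWithin 0 (Set.Ioi 0)) (nhds (∫ y, h y)) := by
    refine tendsto_integral_filter_of_dominated_convergence
      (dom d (C * (1 + d) ^ (d - 1)) ((1 + d) * R)) ?_ ?_ (dom_int d hd _ _) ?_
    · refine Eventually.of_forall fun ε => Measurable.aestronglyMeasurable ?_
      exact (measurable_of_countable (fun m : ZLat d => h (ε • latVec m))).comp
        (flo_meas.comp (measurable_const_smul _))
    · filter_upwards [self_mem_nhdsWithin] with ε hε
      have hε : 0 < ε := hε
      refine Eventually.of_forall fun y => ?_
      rw [Real.norm_eq_abs]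
      set m := flo (ε⁻¹ • y) with hmdef
      by_cases hz : h (ε • latVec m) = 0
      · rw [hz, abs_zero]; exact dom_nonneg (by positivity) y
      have hm0 : m ≠ 0 := by
        intro hm0; rw [hm0, latVec_zero, smul_zero] at hz; exact hz h0
      have hn : ε ≤ ‖ε • latVec m‖ := by
        rw [norm_smul, Real.norm_of_nonneg hε.le]
        nlinarith [latVec_norm_ge m hm0]
      have hy : ‖y‖ ≤ (1 + d) * ‖ε • latVec m‖ := by
        have h1 := near ε hε y
        have h2 : ‖y‖ ≤ ‖y - ε • latVec m‖ + ‖ε • latVec m‖ := by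
          simpa using norm_add_le (y - ε • latVec m) (ε • latVec m)
        have h3 : ε * d ≤ ‖ε • latVec m‖ * d := by gcongr
        linarith
      have hyR : ‖y‖ ≤ (1 + d) * R := hy.trans (by gcongr; exact hs _ hz)
      unfold dom
      rw [Set.indicator_of_mem (show ‖y‖ ∈ Set.Iic _ from hyR)]
      refine (hb _).trans ?_
      rw [mul_assoc]
      gcongr
      have hp : 0 < ‖ε • latVec m‖ := hε.trans_le hn
      by_cases hy0 : y = 0
      · exfalso; apply hm0; rw [hmdef, hy0]; ext i; simp [flo]
      have hyp : 0 < ‖y‖ := norm_pos_iff.2 hy0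
      rw [inv_le_iff_one_le_mul₀ (by positivity), mul_right_comm, ← mul_pow, ← div_eq_mul_inv,
        le_div_iff₀ (by positivity), one_mul]
      gcongr
    · have hae : ∀ᵐ y : EE d, y ≠ 0 := by
        have : Nontrivial (EE d) := inferInstance
        exact Measure.ae_ne volume 0
      filter_upwards [hae] with y hy
      refine (hc y hy).tendsto.comp ?_
      rw [tendsto_iff_norm_sub_tendsto_zero]
      have hl : Tendsto (fun ε : ℝ => ε * d) (nhdsWithin 0 (Set.Ioi 0)) (nhds 0) := by
        have : Tendsto (fun ε : ℝ => ε * d) (nhds 0) (nhds (0 * d)) := tendsto_id.mul_const _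
        rw [zero_mul] at this
        exact this.mono_left nhdsWithin_le_nhds
      refine tendsto_of_tendsto_of_tendsto_of_le_of_le' tendsto_const_nhds hl
        (Eventually.of_forall fun ε => norm_nonneg _) ?_
      filter_upwards [self_mem_nhdsWithin] with ε hε
      rw [norm_sub_rev]; exact near ε hε y
  refine hT.congr' ?_
  filter_upwards [self_mem_nhdsWithin] with ε hε
  exact (key ε hε).symm

lemma trunc {d : ℕ} (hd : 2 ≤ d) {C R : ℝ} (hC : 0 ≤ C) {h : EE d → ℝ}
    (hm : Measurable h)
    (hb : ∀ y, |h y| ≤ C * (‖y‖ ^ (d - 1))⁻¹) (hs : ∀ y, h y ≠ 0 → ‖y‖ ≤ R) :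
    Tendsto (fun r : ℝ => ∫ y in {y : EE d | r < ‖y‖}, h y)
      (nhdsWithin 0 (Set.Ioi 0)) (nhds (∫ y, h y)) := by
  have : Nonempty (Fin d) := ⟨⟨0, by omega⟩⟩
  have hms : ∀ r : ℝ, MeasurableSet {y : EE d | r < ‖y‖} := fun r =>
    measurableSet_lt measurable_const measurable_norm
  simp_rw [fun r => (integral_indicator (μ := volume) (f := h) (hms r)).symm]
  refine tendsto_integral_filter_of_dominated_convergence (dom d C R) ?_ ?_ (dom_int d hd _ _) ?_
  · exact Eventually.of_forall fun r => (hm.indicator (hms r)).aestronglyMeasurable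
  · refine Eventually.of_forall fun r => Eventually.of_forall fun y => ?_
    exact (norm_indicator_le_norm_self _ _).trans (le_dom hC hb hs y)
  · have hae : ∀ᵐ y : EE d, y ≠ 0 := by
      have : Nontrivial (EE d) := inferInstance
      exact Measure.ae_ne volume 0
    filter_upwards [hae] with y hy
    refine tendsto_const_nhds.congr' ?_
    have : ∀ᶠ r : ℝ in nhdsWithin 0 (Set.Ioi 0), r < ‖y‖ :=
      mem_nhdsWithin_of_mem_nhds (Iio_mem_nhds (norm_pos_iff.2 hy))
    filter_upwards [this] with r hr
    rw [Set.indicator_of_mem (show y ∈ {y : EE d | r < ‖y‖} from hr)]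

/-- reflection in coordinate j -/
def cRefl {d : ℕ} (j : Fin d) : EE d ≃ₗᵢ[ℝ] EE d :=
  LinearIsometryEquiv.piLpCongrRight 2 fun i =>
    if i = j then LinearIsometryEquiv.neg ℝ else LinearIsometryEquiv.refl ℝ ℝ

lemma cRefl_apply {d : ℕ} (j i : Fin d) (y : EE d) :
    cRefl j y i = if i = j then - y i else y i := by
  unfold cRefl
  by_cases h : i = j
  · subst h; simp
  · simp [h]

def reflZ {d : ℕ} (j : Fin d) : ZLat d ≃ ZLat d :=
  Function.Involutive.toPerm (fun m i => if i = j then - m i else m i) (by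
    intro m; ext i; by_cases h : i = j <;> simp [h])

lemma reflZ_apply {d : ℕ} (j i : Fin d) (m : ZLat d) :
    reflZ j m i = if i = j then - m i else m i := rfl

lemma latVec_refl {d : ℕ} (j : Fin d) (m : ZLat d) : latVec (reflZ j m) = cRefl j (latVec m) := by
  ext i
  rw [cRefl_apply, latVec_apply, latVec_apply, reflZ_apply]
  split_ifs <;> simp

def rker {d : ℕ} (j k : Fin d) (y : EE d) : ℝ := y j * y k / ‖y‖ ^ (d + 2)

lemma rker_refl {d : ℕ} (j k : Fin d) (hjk : j ≠ k) (y : EE d) :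
    rker j k (cRefl j y) = - rker j k y := by
  unfold rker
  rw [cRefl_apply, cRefl_apply, LinearIsometryEquiv.norm_map]
  simp [hjk.symm, neg_div]

lemma rker_abs {d : ℕ} (j k : Fin d) (y : EE d) : |rker j k y| ≤ ‖y‖ ^ 2 / ‖y‖ ^ (d + 2) := by
  unfold rker
  rw [abs_div, abs_mul, abs_of_nonneg (by positivity : 0 ≤ ‖y‖ ^ (d + 2)), sq]
  gcongr
  · exact coord_le y j
  · exact coord_le y k

lemma rker_meas {d : ℕ} (j k : Fin d) : Measurable (rker j k : EE d → ℝ) := by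
  unfold rker
  refine Measurable.div (Measurable.mul ?_ ?_) ?_ <;> fun_prop

lemma discK_eq {d : ℕ} (j k : Fin d) (m : ZLat d) :
    discK d j k m = cConst d * rker j k (latVec m) := by
  unfold discK rker
  split_ifs with h
  · subst h; simp [latVec_zero]
  · rw [latVec_apply, latVec_apply]; ring

lemma rker_smul {d : ℕ} (j k : Fin d) (ε : ℝ) (hε : 0 < ε) (y : EE d) :
    rker j k y = ε ^ d * rker j k (ε • y) := by
  unfold rker
  rw [norm_smul, Real.norm_of_nonneg hε.le]
  simp only [PiLp.smul_apply, smul_eq_mul]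
  by_cases hy : y = 0
  · subst hy; simp
  have : ‖y‖ ≠ 0 := norm_ne_zero_iff.2 hy
  field_simp
  ring

theorem stmt15 (d : ℕ) (hd : 2 ≤ d) (j k : Fin d) (hjk : j ≠ k)
    (F : EuclideanSpace ℝ (Fin d) → ℝ) (hF : ContDiff ℝ (⊤ : ℕ∞) F) (hFc : HasCompactSupport F)
    (x : EuclideanSpace ℝ (Fin d)) :
    ∃ L : ℝ,
      Filter.Tendsto (fun ε : ℝ => ∑' m : ZLat d, discK d j k m * F (x - ε • latVec m))
        (nhdsWithin 0 (Set.Ioi 0)) (nhds L) ∧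
      Filter.Tendsto (fun r : ℝ =>
          cConst d * ∫ y in {y : EuclideanSpace ℝ (Fin d) | r < ‖y‖},
            y j * y k / ‖y‖ ^ (d + 2) * F (x - y))
        (nhdsWithin 0 (Set.Ioi 0)) (nhds L) := by
  set σ := cRefl j with hσ
  obtain ⟨Lc, hL⟩ := hF.lipschitzWith_of_hasCompactSupport hFc (by simp)
  obtain ⟨R0, hR0⟩ : ∃ R0 : ℝ, ∀ z, F z ≠ 0 → ‖z‖ ≤ R0 := by
    obtain ⟨R0, h⟩ := hFc.isCompact.isBounded.exists_norm_le
    exact ⟨R0, fun z hz => h z (subset_tsupport _ hz)⟩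
  have hFx : ∀ y, F (x - y) ≠ 0 → ‖y‖ ≤ R0 + ‖x‖ := by
    intro y hy
    have h1 := hR0 _ hy
    have h2 : ‖y‖ ≤ ‖x‖ + ‖x - y‖ := by
      simpa using norm_sub_le x (x - y)
    linarith
  have hFcont : Continuous F := hF.continuous
  have hσc : Continuous σ := σ.continuous
  set G : EE d → ℝ := fun y => (F (x - y) - F (x - σ y)) / 2 with hG
  have hGc : Continuous G := by
    simp only [hG]; fun_prop
  set h : EE d → ℝ := fun y => rker j k y * G y with hh
  have hGb : ∀ y, |G y| ≤ Lc * ‖y‖ := by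
    intro y
    have h1 := hL.dist_le_mul (x - y) (x - σ y)
    rw [Real.dist_eq, dist_eq_norm] at h1
    have h2 : ‖x - y - (x - σ y)‖ ≤ 2 * ‖y‖ := by
      have : x - y - (x - σ y) = σ y - y := by abel
      rw [this]
      refine (norm_sub_le _ _).trans ?_
      rw [LinearIsometryEquiv.norm_map]; linarith
    have h3 : (Lc : ℝ) * ‖x - y - (x - σ y)‖ ≤ Lc * (2 * ‖y‖) := by gcongr
    simp only [hG]
    rw [abs_div, abs_two]
    linarith
  have hb : ∀ y, |h y| ≤ Lc * (‖y‖ ^ (d - 1))⁻¹ := by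
    intro y
    simp only [hh]
    rw [abs_mul]
    by_cases hy : y = 0
    · subst hy
      simp [rker]
      positivity
    have hy' : 0 < ‖y‖ := norm_pos_iff.2 hy
    calc _ ≤ ‖y‖ ^ 2 / ‖y‖ ^ (d + 2) * (Lc * ‖y‖) := by
          gcongr
          · exact rker_abs j k y
          · exact hGb y
      _ = _ := by
          obtain ⟨e, rfl⟩ : ∃ e, d = e + 1 := ⟨d - 1, by omega⟩
          simp only [Nat.add_sub_cancel]
          field_simp
          ring
  have hs : ∀ y, h y ≠ 0 → ‖y‖ ≤ R0 + ‖x‖ := by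
    intro y hy
    by_contra hcon
    apply hy
    have h1 : F (x - y) = 0 := by
      by_contra hne; exact hcon (hFx y hne)
    have h2 : F (x - σ y) = 0 := by
      by_contra hne
      have := hFx _ hne
      rw [LinearIsometryEquiv.norm_map] at this
      exact hcon this
    simp [hh, hG, h1, h2]
  have hm : Measurable h := (rker_meas j k).mul hGc.measurable
  have h0 : h 0 = 0 := by simp [hh, rker]
  have hc : ∀ y, y ≠ 0 → ContinuousAt h y := by
    intro y hy
    have : ‖y‖ ^ (d + 2) ≠ 0 := pow_ne_zero _ (norm_ne_zero_iff.2 hy)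
    refine ContinuousAt.mul ?_ hGc.continuousAt
    unfold rker
    refine ContinuousAt.div ?_ ?_ this
    · exact Continuous.continuousAt (by fun_prop)
    · exact Continuous.continuousAt (by fun_prop)
  refine ⟨cConst d * ∫ y, h y, ?_, ?_⟩
  · refine ((riemann hd Lc.2 h0 hc hb hs).const_mul (cConst d)).congr' ?_
    filter_upwards [self_mem_nhdsWithin] with ε hε
    have hε : 0 < ε := hε
    have hsum : Summable fun m : ZLat d => discK d j k m * F (x - ε • latVec m) := by
      refine summable_of_hasFiniteSupport
        ((fin_lat ε hε (R0 + ‖x‖)).subset fun m hm => hFx _ (right_ne_zero_of_mul hm))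
    have hodd : ∀ m, discK d j k (reflZ j m) * F (x - ε • latVec (reflZ j m))
        = - (discK d j k m * F (x - σ (ε • latVec m))) := by
      intro m
      rw [discK_eq, discK_eq, latVec_refl, rker_refl j k hjk, map_smul]
      ring
    have hsum2 : Summable fun m : ZLat d => discK d j k m * F (x - σ (ε • latVec m)) := by
      have := ((reflZ j).summable_iff.2 hsum).neg
      refine this.congr fun m => ?_
      simp only [Function.comp]
      rw [hodd, neg_neg]
    have heq : ∑' m : ZLat d, discK d j k m * F (x - ε • latVec m)
        = - ∑' m : ZLat d, discK d j k m * F (x - σ (ε • latVec m)) := by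
      rw [← (reflZ j).tsum_eq, ← tsum_neg]
      exact tsum_congr hodd
    have hG2 : cConst d * (ε ^ d * ∑' m : ZLat d, h (ε • latVec m))
        = ((∑' m : ZLat d, discK d j k m * F (x - ε • latVec m))
          - ∑' m : ZLat d, discK d j k m * F (x - σ (ε • latVec m))) / 2 := by
      rw [← hsum.tsum_sub hsum2, ← tsum_div_const, ← tsum_mul_left, ← tsum_mul_left]
      refine tsum_congr fun m => ?_
      rw [discK_eq, rker_smul j k ε hε]
      simp only [hh, hG]
      ring
    rw [hG2]
    linarith
  · refine ((trunc hd Lc.2 hm hb hs).const_mul (cConst d)).congr' ?_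
    filter_upwards [self_mem_nhdsWithin] with r hr
    have hr : 0 < r := hr
    congr 1
    set S : Set (EE d) := {y | r < ‖y‖} with hS
    have hSm : MeasurableSet S := measurableSet_lt measurable_const measurable_norm
    have hSσ : σ ⁻¹' S = S := by
      ext y; simp [hS]
    have hFi : Integrable (fun y => F (x - y)) :=
      (hFcont.integrable_of_hasCompactSupport hFc).comp_sub_left x
    have hint : IntegrableOn (fun y => rker j k y * F (x - y)) S := by
      refine Integrable.bdd_mul (c := (r ^ d)⁻¹) hFi.integrableOn
        (rker_meas j k).aestronglyMeasurable ?_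
      filter_upwards [ae_restrict_mem hSm] with y hy
      have hy : r < ‖y‖ := hy
      have hy0 : 0 < ‖y‖ := hr.trans hy
      refine (rker_abs j k y).trans ?_
      have : ‖y‖ ^ 2 / ‖y‖ ^ (d + 2) = (‖y‖ ^ d)⁻¹ := by
        field_simp
        ring
      rw [this]
      gcongr
    have hmp : MeasurePreserving σ volume volume := σ.measurePreserving
    have hemb : MeasurableEmbedding σ := σ.toHomeomorph.measurableEmbedding
    have hodd : ∀ y, rker j k (σ y) * F (x - σ y) = - (rker j k y * F (x - σ y)) := by
      intro y; rw [rker_refl j k hjk]; ring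
    have hint2 : IntegrableOn (fun y => rker j k y * F (x - σ y)) S := by
      have h1 := (hmp.integrableOn_comp_preimage hemb).2 hint
      rw [hSσ] at h1
      refine h1.neg.congr (Eventually.of_forall fun y => ?_)
      simp only [Function.comp, Pi.neg_apply]
      rw [hodd, neg_neg]
    have heq : ∫ y in S, rker j k y * F (x - y) = - ∫ y in S, rker j k y * F (x - σ y) := by
      rw [← hmp.setIntegral_preimage_emb hemb, hSσ, ← integral_neg]
      exact integral_congr_ae (Eventually.of_forall hodd)
    have hG2 : ∫ y in S, h y = ((∫ y in S, rker j k y * F (x - y))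
        - ∫ y in S, rker j k y * F (x - σ y)) / 2 := by
      rw [← integral_sub hint hint2, ← integral_div]
      refine integral_congr_ae (Eventually.of_forall fun y => ?_)
      simp only [hh, hG]
      ring
    change ∫ y in S, h y = ∫ y in S, rker j k y * F (x - y)
    rw [hG2]
    linarith

end
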